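/- Let Λ ⊆ ℂ be a lattice, let s ∈ ℂ satisfy ns ∉ Λ for every integer n ≥ 1, let R be a pinning, and let f be an elliptic function for Λ. Then there exists a unique constant c₀ ∈ ℂ such that for every z ∈ ℂ at which f is analytic, f(z) = c₀ + Σ_{r∈R} Σ_{n∈ℤ} Σ_{k≥1} ((−1)^{k−1} c_k(f, r+ns)/(k−1)!) · ζ_Λ^{(k−1)}(z − r − ns), where all but finitely many summands are zero. -/

import Mathlib

open Filter Topology Set

/-- The Weierstrass zeta function of a lattice `L ⊆ ℂ`. -/
noncomputable def wzeta (L : Set ℂ) (z : ℂ) : ℂ :=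
  1 / z + ∑' l : ↥(L \ {0}), (1 / (z - (l : ℂ)) + 1 / (l : ℂ) + z / (l : ℂ) ^ 2)

/-- `L` is a lattice in `ℂ`. -/
def IsLattice (L : Set ℂ) : Prop :=
  ∃ ω₁ ω₂ : ℂ, LinearIndependent ℝ ![ω₁, ω₂] ∧
    L = {z : ℂ | ∃ m n : ℤ, z = (m : ℂ) * ω₁ + (n : ℂ) * ω₂}

/-- `F` extends analytically to the point `α`. -/
def ExtAnalyticAt (F : ℂ → ℂ) (α : ℂ) : Prop :=
  ∃ g : ℂ → ℂ, AnalyticAt ℂ g α ∧ ∀ᶠ z in 𝓝[≠] α, F z = g z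

/-- `f` is an elliptic function for the lattice `L`: meromorphic on `ℂ` and `L`-periodic. -/
def IsElliptic (L : Set ℂ) (f : ℂ → ℂ) : Prop :=
  MeromorphicOn f Set.univ ∧
    ∀ lam ∈ L, ∀ z : ℂ, AnalyticAt ℂ f z → f (z + lam) = f z

/-- `c : ℕ → ℂ` is the family of principal part coefficients of `f` at `α`
(`c k` is the coefficient of `1/(z-α)^k`; `c 0` is irrelevant and set to `0`). -/
def IsPrincPart (f : ℂ → ℂ) (α : ℂ) (c : ℕ → ℂ) : Prop :=
  c 0 = 0 ∧ (Function.support c).Finite ∧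
    ExtAnalyticAt (fun z => f z - ∑ᶠ k : ℕ, c k / (z - α) ^ k) α

/-- `R` is a pinning: `(r, n, λ) ↦ r + n s + λ` is a bijection from `R × ℤ × L` onto `ℂ`. -/
def IsPinning (L : Set ℂ) (s : ℂ) (R : Set ℂ) : Prop :=
  ∀ z : ℂ, ∃! p : ℂ × ℤ × ℂ, p.1 ∈ R ∧ p.2.2 ∈ L ∧ z = p.1 + (p.2.1 : ℂ) * s + p.2.2

namespace PeriodPair

variable (P : PeriodPair)

/-- The `l`-th summand of the Weierstrass zeta function; for `l = 0` it is `1 / z`. -/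
noncomputable def zetaSummand (l z : ℂ) : ℂ := 1 / (z - l) + 1 / l + z / l ^ 2

/-- The Weierstrass zeta function of `P` with the `l₀`-term missing. -/
noncomputable def zetaExcept (l₀ z : ℂ) : ℂ :=
  ∑' l : P.lattice, if l.1 = l₀ then 0 else zetaSummand l z

lemma zetaSummand_bound (r : ℝ) (hr : 0 < r) (z : ℂ) (hz : ‖z‖ < r) (l : ℂ) (h : 2 * r ≤ ‖l‖) :
    ‖zetaSummand l z‖ ≤ 2 * r ^ 2 * ‖l‖ ^ (-3 : ℝ) := by
  have hl : 0 < ‖l‖ := by linarith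
  have hl0 : l ≠ 0 := norm_pos_iff.mp hl
  have hzl : z - l ≠ 0 := sub_ne_zero.mpr (by rintro rfl; linarith)
  have hn : ‖l‖ / 2 ≤ ‖z - l‖ := by
    rw [norm_sub_rev]
    exact .trans (by linarith) (norm_sub_norm_le l z)
  have he : zetaSummand l z = z ^ 2 / ((z - l) * l ^ 2) := by
    rw [zetaSummand]; field_simp; ring
  calc
    _ = ‖z‖ ^ 2 / (‖z - l‖ * ‖l‖ ^ 2) := by rw [he]; simp
    _ ≤ r ^ 2 / ((‖l‖ / 2) * ‖l‖ ^ 2) := by gcongr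
    _ = 2 * r ^ 2 / ‖l‖ ^ 3 := by field_simp
    _ = _ := by norm_cast

lemma hasSumLocallyUniformly_zetaExcept (l₀ : ℂ) :
    HasSumLocallyUniformly
      (fun (l : P.lattice) (z : ℂ) ↦ if l.1 = l₀ then 0 else zetaSummand l z)
      (P.zetaExcept l₀) := by
  refine P.hasSumLocallyUniformly_aux (u := (2 * · ^ 2 * ‖·‖ ^ (-3 : ℝ))) _
    (fun _ _ ↦ (ZLattice.summable_norm_rpow _ _ (by simp; norm_num)).mul_left _) fun r hr ↦
    Filter.eventually_atTop.mpr ⟨2 * r, ?_⟩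
  rintro _ h s hs l rfl
  split_ifs
  · simpa using! show 0 ≤ 2 * r ^ 2 * (‖(l : ℂ)‖ ^ 3)⁻¹ by positivity
  · exact zetaSummand_bound r hr s hs l h

lemma differentiableAt_zetaSummand {l z : ℂ} (h : z ≠ l) :
    DifferentiableAt ℂ (zetaSummand l) z := by
  unfold zetaSummand
  exact .add (.add (.div (by fun_prop) (by fun_prop) (sub_ne_zero.mpr h)) (by fun_prop))
    (by fun_prop)

lemma hasDerivAt_zetaSummand {l z : ℂ} (h : z ≠ l) :
    HasDerivAt (zetaSummand l) (-(1 / (z - l) ^ 2 - 1 / l ^ 2)) z := by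
  have h0 := sub_ne_zero.mpr h
  have h1 : HasDerivAt (fun z : ℂ ↦ (z - l)⁻¹) (-1 / (z - l) ^ 2) z :=
    ((hasDerivAt_id z).sub_const l).fun_inv h0
  have h2 : HasDerivAt (fun z : ℂ ↦ z / l ^ 2) (1 / l ^ 2) z :=
    (hasDerivAt_id z).div_const _
  convert! (h1.add_const (1 / l)).add h2 using 1
  · ext w; simp [zetaSummand]
  · ring

lemma analyticOnNhd_zetaExcept (l₀ : ℂ) :
    AnalyticOnNhd ℂ (P.zetaExcept l₀) (P.lattice \ {l₀})ᶜ := by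
  refine DifferentiableOn.analyticOnNhd ?_ P.isOpen_compl_lattice_sdiff
  refine (P.hasSumLocallyUniformly_zetaExcept l₀).hasSumLocallyUniformlyOn.differentiableOn
    (.of_forall fun s ↦ .fun_sum fun i hi ↦ ?_) P.isOpen_compl_lattice_sdiff
  split_ifs with hi
  · simp
  · intro z hz
    refine (differentiableAt_zetaSummand ?_).differentiableWithinAt
    rintro rfl
    simp_all

lemma zetaExcept_add (l₀ : P.lattice) (z : ℂ) :
    P.zetaExcept l₀ z + zetaSummand l₀ z = ∑' l : P.lattice, zetaSummand l z := by
  trans P.zetaExcept l₀ z + ∑' i : P.lattice, if i.1 = l₀.1 then zetaSummand l₀ z else 0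
  · simp
  rw [zetaExcept, ← Summable.tsum_add]
  · congr with w; split_ifs <;> simp only [zero_add, add_zero, *]
  · exact ⟨_, (P.hasSumLocallyUniformly_zetaExcept l₀).hasSum⟩
  · exact summable_of_hasFiniteSupport ((Set.finite_singleton l₀).subset (by simp))

lemma wzeta_eq_tsum (z : ℂ) :
    wzeta P.lattice z = ∑' l : P.lattice, zetaSummand l z := by
  rw [← P.zetaExcept_add 0, add_comm, wzeta]
  congr 1
  · simp [zetaSummand]
  · have h1 : P.zetaExcept ((0 : P.lattice) : ℂ) z
        = ∑' l : P.lattice, ((P.lattice : Set ℂ) \ {0}).indicator (fun l ↦ zetaSummand l z) l := by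
      rw [zetaExcept]
      congr with l
      by_cases h : l.1 = 0 <;> simp [h]
    rw [h1]
    refine (tsum_subtype ((P.lattice : Set ℂ) \ {0}) (fun l ↦ zetaSummand l z)).trans ?_
    refine ((tsum_subtype (P.lattice : Set ℂ) _).trans ?_).symm
    congr with l
    simp [Set.indicator]
    tauto

lemma wzeta_eq_zetaExcept_add (l₀ : P.lattice) (z : ℂ) :
    wzeta P.lattice z = P.zetaExcept l₀ z + zetaSummand l₀ z := by
  rw [zetaExcept_add, wzeta_eq_tsum]

lemma wzeta_eq_zetaExcept_of_notMem {l₀ : ℂ} (hl : l₀ ∉ P.lattice) :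
    wzeta P.lattice = P.zetaExcept l₀ := by
  ext z
  rw [wzeta_eq_tsum, zetaExcept]
  congr with l
  rw [if_neg]
  rintro rfl
  exact hl l.2

lemma analyticAt_wzeta {z : ℂ} (hz : z ∉ P.lattice) : AnalyticAt ℂ (wzeta P.lattice) z := by
  rw [P.wzeta_eq_zetaExcept_of_notMem hz]
  exact P.analyticOnNhd_zetaExcept z z (by simp)

lemma exists_wzeta_eq_inv_add {l : ℂ} (hl : l ∈ P.lattice) :
    ∃ g : ℂ → ℂ, AnalyticAt ℂ g l ∧ ∀ z, wzeta P.lattice z = 1 / (z - l) + g z := by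
  refine ⟨fun z ↦ P.zetaExcept l z + (1 / l + z / l ^ 2), ?_, fun z ↦ ?_⟩
  · refine (P.analyticOnNhd_zetaExcept l l (by simp)).add ?_
    exact Differentiable.analyticAt (by fun_prop) _
  · rw [P.wzeta_eq_zetaExcept_add ⟨l, hl⟩, zetaSummand]
    ring

lemma not_continuousAt_wzeta {l : ℂ} (hl : l ∈ P.lattice) :
    ¬ ContinuousAt (wzeta P.lattice) l := by
  obtain ⟨g, hg, h⟩ := P.exists_wzeta_eq_inv_add hl
  intro H
  apply (NormedField.continuousAt_zpow (n := -1) (x := (0 : ℂ))).not.mpr (by simp)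
  have h1 : ContinuousAt (fun z ↦ wzeta P.lattice z - g z) l := H.sub hg.continuousAt
  have h2 : ContinuousAt (fun z ↦ (z - l)⁻¹) l := by
    convert! h1 using 2 with z
    simp [h]
  simpa [Function.comp_def] using! h2.comp_of_eq (continuous_const_add l).continuousAt (add_zero _)

lemma hasDerivAt_wzeta {z : ℂ} (hz : z ∉ P.lattice) :
    HasDerivAt (wzeta P.lattice) (-P.weierstrassP z) z := by
  have hU : IsOpen (P.lattice : Set ℂ)ᶜ := P.isClosed_lattice.isOpen_compl
  have hs := P.hasSumLocallyUniformly_zetaExcept z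
  rw [← P.wzeta_eq_zetaExcept_of_notMem hz] at hs
  have key : Set.EqOn (deriv (wzeta P.lattice)) (-P.weierstrassP) (P.lattice : Set ℂ)ᶜ := by
    have hne : ∀ i : P.lattice, ∀ w ∈ (P.lattice : Set ℂ)ᶜ, w ≠ i := by
      rintro i w hw rfl
      exact hw i.2
    have hz' : ∀ i : P.lattice, i.1 ≠ z := by
      rintro i rfl
      exact hz i.2
    refine (hs.tendstoLocallyUniformlyOn.deriv (.of_forall fun s ↦ ?_) hU).unique ?_
    · refine .fun_sum fun i _ w hw ↦ ?_
      simp only [hz', if_false]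
      exact (differentiableAt_zetaSummand (hne i w hw)).differentiableWithinAt
    · refine P.hasSumLocallyUniformly_weierstrassP.tendstoLocallyUniformlyOn.fun_neg.congr ?_
      intro s w hw
      simp only [hz', if_false, Function.comp_apply]
      rw [deriv_fun_sum fun i _ ↦ differentiableAt_zetaSummand (hne i w hw),
        ← Finset.sum_neg_distrib]
      exact Finset.sum_congr rfl fun i _ ↦ (hasDerivAt_zetaSummand (hne i w hw)).deriv.symm
  have := (P.analyticAt_wzeta hz).differentiableAt.hasDerivAt
  rwa [key hz] at this

/-- This is true globally because of junk values. -/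
lemma deriv_wzeta : deriv (wzeta P.lattice) = -P.weierstrassP := by
  ext z
  by_cases hz : z ∈ P.lattice
  · rw [deriv_zero_of_not_differentiableAt
      fun H ↦ P.not_continuousAt_wzeta hz H.continuousAt]
    simp [P.weierstrassP_coe ⟨z, hz⟩]
  · exact (P.hasDerivAt_wzeta hz).deriv

lemma wzeta_neg (z : ℂ) : wzeta P.lattice (-z) = -wzeta P.lattice z := by
  rw [wzeta_eq_tsum, wzeta_eq_tsum, ← (Equiv.neg P.lattice).tsum_eq, ← tsum_neg]
  congr with l
  have : -z + (l : ℂ) = -(z - l) := by ring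
  simp only [zetaSummand, Equiv.neg_apply, NegMemClass.coe_neg, sub_neg_eq_add, this, div_neg,
    neg_sq]
  ring

lemma isPreconnected_compl_lattice : IsPreconnected (P.lattice : Set ℂ)ᶜ := by
  have hc : (P.lattice : Set ℂ).Countable :=
    Set.countable_coe_iff.mp P.latticeEquivProd.injective.countable
  exact (hc.isPathConnected_compl_of_one_lt_rank (by simp)).isConnected.isPreconnected

lemma add_mem_lattice_iff {l z : ℂ} (hl : l ∈ P.lattice) :
    z + l ∈ P.lattice ↔ z ∈ P.lattice := by
  exact add_mem_cancel_right hl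

lemma exists_wzeta_add_eq {l : ℂ} (hl : l ∈ P.lattice) :
    ∃ η : ℂ, ∀ z ∉ P.lattice, wzeta P.lattice (z + l) = wzeta P.lattice z + η := by
  have hd : ∀ z ∈ (P.lattice : Set ℂ)ᶜ, HasDerivAt
      (fun z ↦ wzeta P.lattice (z + l) - wzeta P.lattice z) 0 z := by
    intro z hz
    have h1 := (P.hasDerivAt_wzeta (z := z + l)
      (mt (P.add_mem_lattice_iff hl).mp hz)).comp_add_const z l
    convert! h1.fun_sub (P.hasDerivAt_wzeta hz) using 1
    rw [P.weierstrassP_add_coe z ⟨l, hl⟩]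
    simp
  obtain ⟨η, h⟩ := P.isClosed_lattice.isOpen_compl.exists_is_const_of_deriv_eq_zero
    P.isPreconnected_compl_lattice
    (fun z hz ↦ (hd z hz).differentiableAt.differentiableWithinAt) (fun z hz ↦ (hd z hz).deriv)
  exact ⟨η, fun z hz ↦ by rw [← h z hz]; ring⟩

end PeriodPair

namespace ExtAnalyticAt

variable {F G : ℂ → ℂ} {α : ℂ}

lemma of_analyticAt (h : AnalyticAt ℂ F α) : ExtAnalyticAt F α := ⟨F, h, .of_forall fun _ ↦ rfl⟩

lemma congr (h : ExtAnalyticAt F α) (hFG : ∀ᶠ z in 𝓝[≠] α, F z = G z) : ExtAnalyticAt G α := by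
  obtain ⟨g, hg, e⟩ := h
  refine ⟨g, hg, ?_⟩
  filter_upwards [e, hFG] with z h1 h2
  rw [← h2, h1]

lemma sub (hF : ExtAnalyticAt F α) (hG : ExtAnalyticAt G α) :
    ExtAnalyticAt (fun z ↦ F z - G z) α := by
  obtain ⟨f, hf, ef⟩ := hF
  obtain ⟨g, hg, eg⟩ := hG
  refine ⟨fun z ↦ f z - g z, hf.fun_sub hg, ?_⟩
  filter_upwards [ef, eg] with z h1 h2
  rw [h1, h2]

lemma const_mul (a : ℂ) (hF : ExtAnalyticAt F α) : ExtAnalyticAt (fun z ↦ a * F z) α := by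
  obtain ⟨f, hf, ef⟩ := hF
  refine ⟨fun z ↦ a * f z, analyticAt_const.fun_mul hf, ?_⟩
  filter_upwards [ef] with z h1
  rw [h1]

lemma sum {ι : Type*} {S : Finset ι} {F : ι → ℂ → ℂ} (h : ∀ i ∈ S, ExtAnalyticAt (F i) α) :
    ExtAnalyticAt (fun z ↦ ∑ i ∈ S, F i z) α := by
  choose! f hf ef using h
  refine ⟨fun z ↦ ∑ i ∈ S, f i z, S.analyticAt_fun_sum hf, ?_⟩
  filter_upwards [(S.eventually_all).mpr ef] with z hz
  exact Finset.sum_congr rfl hz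

/-- A function with only removable singularities agrees with an entire function. -/
lemma exists_entire (h : ∀ α, ExtAnalyticAt F α) :
    ∃ f : ℂ → ℂ, Differentiable ℂ f ∧ ∀ α, ∀ᶠ z in 𝓝[≠] α, F z = f z := by
  choose g hg eg using h
  have key : ∀ α, ∀ᶠ z in 𝓝 α, g z z = g α z := by
    intro α
    have h1 := eventually_eventually_nhdsWithin.mpr (eg α)
    rw [eventually_nhdsWithin_iff] at h1
    filter_upwards [h1, (hg α).eventually_analyticAt] with z h2 h3
    rcases eq_or_ne z α with rfl | hz
    · rfl
    · have h4 : ∀ᶠ w in 𝓝[≠] z, F w = g α w := by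
        have h5 := h2 hz
        rw [isOpen_compl_singleton.nhdsWithin_eq hz] at h5
        exact h5.filter_mono nhdsWithin_le_nhds
      have h5 : ∀ᶠ w in 𝓝[≠] z, g z w = g α w := by
        filter_upwards [h4, eg z] with w h6 h7
        rw [← h6, h7]
      exact tendsto_nhds_unique_of_frequently_eq
        (((hg z).continuousAt.tendsto).mono_left nhdsWithin_le_nhds)
        ((h3.continuousAt.tendsto).mono_left nhdsWithin_le_nhds) h5.frequently
  refine ⟨fun z ↦ g z z, fun α ↦ ((hg α).congr ?_).differentiableAt, fun α ↦ ?_⟩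
  · filter_upwards [key α] with z hz using hz.symm
  · filter_upwards [eg α, (key α).filter_mono nhdsWithin_le_nhds] with z h1 h2
    rw [h1, h2]

end ExtAnalyticAt

/-- Two functions continuous at `α` that agree on a punctured neighbourhood agree at `α`. -/
lemma eq_of_eventuallyEq_nhdsNE {F G : ℂ → ℂ} {α : ℂ} (hF : ContinuousAt F α)
    (hG : ContinuousAt G α) (h : ∀ᶠ z in 𝓝[≠] α, F z = G z) : F α = G α :=
  tendsto_nhds_unique_of_frequently_eq (hF.tendsto.mono_left nhdsWithin_le_nhds)
    (hG.tendsto.mono_left nhdsWithin_le_nhds) h.frequently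

lemma tendsto_add_const_nhdsNE (α l : ℂ) : Tendsto (· + l) (𝓝[≠] α) (𝓝[≠] (α + l)) :=
  tendsto_nhdsWithin_iff.mpr
    ⟨((continuous_add_const l).tendsto α).mono_left nhdsWithin_le_nhds,
      eventually_nhdsWithin_of_forall fun z hz ↦ by simpa using hz⟩

namespace IsPrincPart

variable {f : ℂ → ℂ} {α : ℂ} {c c' : ℕ → ℂ}

lemma extAnalyticAt_sum (h : IsPrincPart f α c) {N : ℕ} (hN : ∀ k, N ≤ k → c k = 0) :
    ExtAnalyticAt (fun z ↦ f z - ∑ k ∈ Finset.range N, c k / (z - α) ^ k) α := by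
  refine h.2.2.congr (.of_forall fun z ↦ ?_)
  rw [finsum_eq_sum_of_support_subset]
  intro k hk
  by_contra hk'
  exact hk (by simp [hN k (by simpa using hk')])

lemma exists_bound (h : IsPrincPart f α c) : ∃ N, ∀ k, N ≤ k → c k = 0 := by
  obtain ⟨N, hN⟩ := h.2.1.bddAbove
  refine ⟨N + 1, fun k hk ↦ ?_⟩
  by_contra h0
  have := hN h0
  omega

lemma eq_zero_of_extAnalyticAt_sum {d : ℕ → ℂ} (h0 : d 0 = 0) (N : ℕ)
    (h : ExtAnalyticAt (fun z ↦ ∑ k ∈ Finset.range N, d k / (z - α) ^ k) α) :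
    ∀ k < N, d k = 0 := by
  induction N with
  | zero => simp
  | succ N ih =>
    have hdN : d N = 0 := by
      rcases Nat.eq_zero_or_pos N with rfl | hNpos
      · exact h0
      obtain ⟨g, hg, eg⟩ := h
      have e : ∀ᶠ z in 𝓝[≠] α, ∑ k ∈ Finset.range (N + 1), d k * (z - α) ^ (N - k)
          = (z - α) ^ N * g z := by
        filter_upwards [eg, self_mem_nhdsWithin] with z hz hne
        have hne : z - α ≠ 0 := sub_ne_zero.mpr hne
        rw [← hz, Finset.mul_sum]
        refine Finset.sum_congr rfl fun k hk ↦ ?_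
        have hk : k ≤ N := by simpa [Nat.lt_succ_iff] using hk
        rw [← Nat.sub_add_cancel hk, pow_add]
        simp only [Nat.add_sub_cancel]
        field_simp
      have := eq_of_eventuallyEq_nhdsNE (by fun_prop)
        (ContinuousAt.mul (by fun_prop) hg.continuousAt) e
      rw [Finset.sum_range_succ, Finset.sum_eq_zero] at this
      · simpa [hNpos.ne'] using this
      · intro k hk
        have : N - k ≠ 0 := by simp at hk; omega
        simp [this]
    intro k hk
    rcases Nat.lt_succ_iff_lt_or_eq.mp hk with hk | rfl
    · refine ih (h.congr (.of_forall fun z ↦ ?_)) k hk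
      simp [Finset.sum_range_succ, hdN]
    · exact hdN

lemma unique (h : IsPrincPart f α c) (h' : IsPrincPart f α c') : c = c' := by
  obtain ⟨N, hN⟩ := h.exists_bound
  obtain ⟨N', hN'⟩ := h'.exists_bound
  have h1 := h.extAnalyticAt_sum (N := max N N') fun k hk ↦ hN k (le_of_max_le_left hk)
  have h2 := h'.extAnalyticAt_sum (N := max N N') fun k hk ↦ hN' k (le_of_max_le_right hk)
  have h3 := eq_zero_of_extAnalyticAt_sum (d := fun k ↦ c k - c' k) (by simp [h.1, h'.1])
    (max N N') (α := α) ((h2.sub h1).congr (.of_forall fun z ↦ by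
      simp only [sub_div, Finset.sum_sub_distrib]; ring))
  ext k
  rcases lt_or_ge k (max N N') with hk | hk
  · exact sub_eq_zero.mp (h3 k hk)
  · rw [hN k (le_of_max_le_left hk), hN' k (le_of_max_le_right hk)]

lemma zero_of_analyticAt (h : AnalyticAt ℂ f α) : IsPrincPart f α 0 := by
  refine ⟨rfl, by simp, ?_⟩
  simpa using ExtAnalyticAt.of_analyticAt h

lemma eq_zero_of_analyticAt (h : IsPrincPart f α c) (hf : AnalyticAt ℂ f α) : c = 0 :=
  h.unique (zero_of_analyticAt hf)

lemma of_add_const {l : ℂ} (h : IsPrincPart f (α + l) c)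
    (hf : ∀ᶠ z in 𝓝[≠] α, f (z + l) = f z) : IsPrincPart f α c := by
  refine ⟨h.1, h.2.1, ?_⟩
  obtain ⟨g, hg, eg⟩ := h.2.2
  refine ⟨fun z ↦ g (z + l), hg.comp_of_eq (by fun_prop) rfl, ?_⟩
  filter_upwards [(tendsto_add_const_nhdsNE α l).eventually eg, hf] with z h1 h2
  simpa [h2] using h1

end IsPrincPart

namespace IsElliptic

variable {L : Set ℂ} {f : ℂ → ℂ}

lemma eventually_analyticAt (hf : IsElliptic L f) (α : ℂ) :
    ∀ᶠ z in 𝓝[≠] α, AnalyticAt ℂ f z :=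
  (hf.1 α (mem_univ α)).eventually_analyticAt

lemma eventually_add_eq (hf : IsElliptic L f) {l : ℂ} (hl : l ∈ L) (α : ℂ) :
    ∀ᶠ z in 𝓝[≠] α, f (z + l) = f z :=
  (hf.eventually_analyticAt α).mono (hf.2 l hl)

lemma princPart_add_eq (hf : IsElliptic L f) {c : ℂ → ℕ → ℂ}
    (hc : ∀ α, IsPrincPart f α (c α)) {l : ℂ} (hl : l ∈ L) (α : ℂ) : c (α + l) = c α :=
  ((hc _).of_add_const (hf.eventually_add_eq hl α)).unique (hc α)

lemma finite_inter_of_isCompact (hf : IsElliptic L f) {c : ℂ → ℕ → ℂ}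
    (hc : ∀ α, IsPrincPart f α (c α)) {K : Set ℂ} (hK : IsCompact K) :
    (K ∩ {α | c α ≠ 0}).Finite := by
  have h : ∀ α ∈ K, {z | z ≠ α → c z = 0} ∈ 𝓝 α := fun α _ ↦ by
    have := (hf.eventually_analyticAt α).mono fun z hz ↦ (hc z).eq_zero_of_analyticAt hz
    exact eventually_nhdsWithin_iff.mp this
  obtain ⟨t, _, ht⟩ := hK.elim_nhds_subcover _ h
  refine t.finite_toSet.subset fun z ⟨hzK, hz⟩ ↦ ?_
  obtain ⟨α, hα, hzα⟩ := Set.mem_iUnion₂.mp (ht hzK)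
  by_cases h : z = α
  · exact h ▸ hα
  · exact absurd (hzα h) hz

end IsElliptic

namespace PeriodPair

variable (P : PeriodPair)

lemma exists_isCompact_add_mem :
    ∃ K : Set ℂ, IsCompact K ∧ ∀ z, ∃ l ∈ P.lattice, z + l ∈ K := by
  refine ⟨closure (ZSpan.fundamentalDomain P.basis),
    (ZSpan.fundamentalDomain_isBounded P.basis).isCompact_closure, fun z ↦ ?_⟩
  refine ⟨-(ZSpan.floor P.basis z : ℂ), neg_mem ?_, subset_closure ?_⟩
  · rw [P.lattice_eq_span_range_basis]
    exact (ZSpan.floor P.basis z).2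
  · rw [← sub_eq_add_neg]
    exact ZSpan.fract_mem_fundamentalDomain P.basis z

/-- Liouville's theorem for doubly periodic functions. -/
lemma apply_eq_apply_of_periodic {f : ℂ → ℂ} (hf : Differentiable ℂ f)
    (hp : ∀ l ∈ P.lattice, ∀ z, f (z + l) = f z) (z w : ℂ) : f z = f w := by
  obtain ⟨K, hK, h⟩ := P.exists_isCompact_add_mem
  refine hf.apply_eq_apply_of_bounded ((hK.image hf.continuous).isBounded.subset ?_) z w
  rintro _ ⟨x, rfl⟩
  obtain ⟨l, hl, hx⟩ := h x
  exact ⟨x + l, hx, hp l hl x⟩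

lemma iteratedDeriv_wzeta_add {l : ℂ} (hl : l ∈ P.lattice) (m : ℕ) (z : ℂ) :
    iteratedDeriv (m + 1) (wzeta P.lattice) (z + l) =
      iteratedDeriv (m + 1) (wzeta P.lattice) z := by
  have h : (fun z ↦ -P.weierstrassP (z + l)) = fun z ↦ -P.weierstrassP z :=
    funext fun z ↦ by rw [P.weierstrassP_add_coe z ⟨l, hl⟩]
  rw [iteratedDeriv_succ', deriv_wzeta]
  exact (congrFun (iteratedDeriv_comp_add_const m (-P.weierstrassP) l) z).symm.trans
    (congrArg (fun g ↦ iteratedDeriv m g z) h)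

lemma extAnalyticAt_iteratedDeriv_wzeta_sub {l : ℂ} (hl : l ∈ P.lattice) (m : ℕ) :
    ExtAnalyticAt (fun z ↦ iteratedDeriv m (wzeta P.lattice) z -
      (-1) ^ m * (Nat.factorial m : ℂ) / (z - l) ^ (m + 1)) l := by
  induction m with
  | zero =>
    obtain ⟨g, hg, h⟩ := P.exists_wzeta_eq_inv_add hl
    exact ⟨g, hg, .of_forall fun z ↦ by simp [h]⟩
  | succ m ih =>
    obtain ⟨g, hg, h⟩ := ih
    refine ⟨deriv g, hg.deriv, ?_⟩
    have h' := eventually_eventually_nhdsWithin.mpr h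
    have hga := hg.eventually_analyticAt.filter_mono (nhdsWithin_le_nhds (s := {l}ᶜ))
    filter_upwards [h', hga, self_mem_nhdsWithin] with z hz hgz hzl
    rw [isOpen_compl_singleton.nhdsWithin_eq hzl] at hz
    have hne : z - l ≠ 0 := sub_ne_zero.mpr hzl
    have e : iteratedDeriv m (wzeta P.lattice) =ᶠ[𝓝 z]
        fun w ↦ (-1) ^ m * (Nat.factorial m : ℂ) * ((w - l) ^ (m + 1))⁻¹ + g w := by
      filter_upwards [hz] with w hw
      rw [← hw]; ring
    have hd : HasDerivAt
        (fun w ↦ (-1) ^ m * (Nat.factorial m : ℂ) * ((w - l) ^ (m + 1))⁻¹ + g w)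
        ((-1) ^ m * (Nat.factorial m : ℂ) *
          (-((m + 1 : ℕ) * (z - l) ^ m * 1) / ((z - l) ^ (m + 1)) ^ 2) + deriv g z) z :=
      (((((hasDerivAt_id z).sub_const l).fun_pow (m + 1)).fun_inv (pow_ne_zero _ hne)).const_mul
        _).add hgz.differentiableAt.hasDerivAt
    rw [iteratedDeriv_succ, e.deriv_eq, hd.deriv, Nat.factorial_succ]
    push_cast
    field_simp
    ring

lemma analyticAt_iteratedDeriv_wzeta {z : ℂ} (hz : z ∉ P.lattice) (m : ℕ) :
    AnalyticAt ℂ (iteratedDeriv m (wzeta P.lattice)) z :=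
  iteratedDeriv_eq_iterate (𝕜 := ℂ) (f := wzeta P.lattice) ▸ (P.analyticAt_wzeta hz).iterated_deriv m

lemma eventually_notMem_lattice (α : ℂ) : ∀ᶠ z in 𝓝[≠] α, z ∉ P.lattice := by
  rw [eventually_nhdsWithin_iff]
  filter_upwards [P.compl_lattice_sdiff_singleton_mem_nhds α] with z hz hne hzP
  exact hz ⟨hzP, hne⟩

/-- The quasi-periods of `ζ` are not `ℂ`-linear in the lattice point. -/
lemma not_forall_wzeta_add_eq (t : ℂ) : ¬ ∀ l ∈ P.lattice, ∀ z ∉ P.lattice,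
    wzeta P.lattice (z + l) = wzeta P.lattice z + t * l := by
  intro H
  set u : ℂ → ℂ := fun z ↦ wzeta P.lattice z - t * z with hu
  have hper : ∀ l ∈ P.lattice, ∀ z ∉ P.lattice, u (z + l) = u z := fun l hl z hz ↦ by
    simp only [hu, H l hl z hz]; ring
  have hana : ∀ z ∉ P.lattice, AnalyticAt ℂ u z := fun z hz ↦
    (P.analyticAt_wzeta hz).fun_sub (by fun_prop)
  have hpole : ∀ a ∈ P.lattice, ∃ g : ℂ → ℂ, AnalyticAt ℂ g a ∧ ∀ z, u z = 1 / (z - a) + g z := by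
    intro a ha
    obtain ⟨g, hg, h⟩ := P.exists_wzeta_eq_inv_add ha
    exact ⟨fun z ↦ g z - t * z, hg.fun_sub (by fun_prop), fun z ↦ by simp only [hu, h]; ring⟩
  have hhalf : ∀ a ∉ P.lattice, 2 * a ∈ P.lattice → u a = 0 := by
    intro a ha h2
    have h1 := hper _ h2 (-a) (by simpa using ha)
    rw [show -a + 2 * a = a by ring] at h1
    have h3 : u (-a) = -u a := by simp only [hu, wzeta_neg]; ring
    rw [h3] at h1
    linear_combination h1 / 2
  have hprod : ∀ v w : ℂ → ℂ, ∀ a : ℂ,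
      (∃ g : ℂ → ℂ, AnalyticAt ℂ g a ∧ ∀ z, v z = 1 / (z - a) + g z) →
      AnalyticAt ℂ w a → w a = 0 → ExtAnalyticAt (fun z ↦ v z * w z) a := by
    rintro v w a ⟨g, hg, h⟩ hw hwa
    obtain ⟨p, hp⟩ := hw
    refine ⟨fun z ↦ dslope w a z + g z * w z, ?_, ?_⟩
    · exact AnalyticAt.fun_add ⟨_, hp.has_fpower_series_dslope_fslope⟩ (hg.fun_mul ⟨p, hp⟩)
    · filter_upwards [self_mem_nhdsWithin] with z hz
      rw [dslope_of_ne _ hz, slope_def_field, hwa, h]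
      ring
  set b := P.ω₁ / 2 with hb
  have hbL : b ∉ P.lattice := P.ω₁_div_two_notMem_lattice
  have h2b : 2 * b ∈ P.lattice := by
    rw [hb, mul_div_cancel₀ _ two_ne_zero]; exact P.ω₁_mem_lattice
  have hext : ∀ a, ExtAnalyticAt (fun z ↦ u z * u (z + b)) a := by
    intro a
    by_cases ha : a ∈ P.lattice
    · have hab : a + b ∉ P.lattice := fun h ↦ hbL ((add_mem_cancel_left ha).mp h)
      refine hprod u (fun z ↦ u (z + b)) a (hpole a ha) ?_ (hhalf _ hab ?_)
      · exact (hana _ hab).comp_of_eq (by fun_prop) rfl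
      · rw [mul_add, two_mul]
        exact add_mem (add_mem ha ha) h2b
    by_cases hab : a + b ∈ P.lattice
    · refine (hprod (fun z ↦ u (z + b)) u a ?_ (hana a ha) (hhalf a ha ?_)).congr
        (.of_forall fun z ↦ mul_comm _ _)
      · obtain ⟨g, hg, h⟩ := hpole _ hab
        exact ⟨fun z ↦ g (z + b), hg.comp_of_eq (by fun_prop) rfl, fun z ↦ by rw [h]; ring_nf⟩
      · rw [show 2 * a = (a + b) + (a + b) - 2 * b by ring]
        exact sub_mem (add_mem hab hab) h2b
    · exact .of_analyticAt
        ((hana a ha).fun_mul ((hana _ hab).comp_of_eq (f := (· + b)) (by fun_prop) rfl))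
  obtain ⟨h, hd, he⟩ := ExtAnalyticAt.exists_entire hext
  have hshift : ∀ α, ∀ᶠ z in 𝓝[≠] α, z + b ∉ P.lattice := fun α ↦
    (tendsto_add_const_nhdsNE α b).eventually (P.eventually_notMem_lattice _)
  have hhper : ∀ l ∈ P.lattice, ∀ z, h (z + l) = h z := by
    intro l hl z
    refine eq_of_eventuallyEq_nhdsNE (F := fun z ↦ h (z + l)) (α := z)
      (hd.continuous.comp (continuous_add_const l)).continuousAt hd.continuous.continuousAt ?_
    filter_upwards [he z, (tendsto_add_const_nhdsNE z l).eventually (he (z + l)),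
      P.eventually_notMem_lattice z, hshift z] with w h1 h2 h3 h4
    rw [← h1, ← h2, hper l hl w h3, add_right_comm, hper l hl _ h4]
  have hconst := P.apply_eq_apply_of_periodic hd hhper
  have hq : P.ω₂ / 2 ∉ P.lattice := P.ω₂_div_two_notMem_lattice
  have hqb : P.ω₂ / 2 + b ∉ P.lattice := by
    have := (P.mul_ω₁_add_mul_ω₂_mem_lattice (α := 1 / 2) (β := 1 / 2)).not.mpr (by norm_num)
    convert! this using 2
    push_cast; ring
  have hz0 : h (P.ω₂ / 2) = 0 := by
    have huq := hhalf _ hq (by rw [mul_div_cancel₀ _ two_ne_zero]; exact P.ω₂_mem_lattice)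
    have hc : ContinuousAt (fun z ↦ u z * u (z + b)) (P.ω₂ / 2) :=
      (hana _ hq).continuousAt.mul
        ((hana _ hqb).continuousAt.comp_of_eq (continuous_add_const b).continuousAt rfl)
    rw [← eq_of_eventuallyEq_nhdsNE hc hd.continuous.continuousAt (he _), huq, zero_mul]
  have hne0 : ∀ᶠ z in 𝓝[≠] (0 : ℂ), u z ≠ 0 := by
    obtain ⟨g, hg, hgu⟩ := hpole 0 P.lattice.zero_mem
    have hc : ContinuousAt (fun z ↦ 1 + z * g z) 0 :=
      continuousAt_const.add (continuousAt_id.mul hg.continuousAt)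
    have := (hc.eventually_ne (y := 0) (by simp)).filter_mono (nhdsWithin_le_nhds (s := {0}ᶜ))
    filter_upwards [this, self_mem_nhdsWithin] with z hz hz0 h0
    have hz0 : z ≠ 0 := hz0
    refine hz ?_
    rw [hgu, sub_zero] at h0
    field_simp at h0
    rwa [mul_zero] at h0
  have hzero : ∀ᶠ z in 𝓝[≠] (0 : ℂ), u (z + b) = 0 := by
    filter_upwards [he 0, hne0] with z h1 h2
    rw [hconst z (P.ω₂ / 2), hz0] at h1
    exact (mul_eq_zero.mp h1).resolve_left h2
  have hfreq : ∃ᶠ z in 𝓝[≠] b, u z = 0 := by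
    have := (tendsto_add_const_nhdsNE 0 b).frequently (p := fun z ↦ u z = 0) hzero.frequently
    rwa [zero_add] at this
  have hall := AnalyticOnNhd.eqOn_zero_of_preconnected_of_frequently_eq_zero
    (U := (P.lattice : Set ℂ)ᶜ) hana P.isPreconnected_compl_lattice hbL hfreq
  obtain ⟨z, hz1, hz2⟩ := (hne0.and (P.eventually_notMem_lattice 0)).exists
  exact hz1 (hall hz2)

end PeriodPair

namespace PeriodPair

variable (P : PeriodPair)

/-- The combination of derivatives of `ζ(z - β)` with principal part `∑ k, a k / (z - β) ^ k`
at `β`. -/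
noncomputable def zetaPart (a : ℕ → ℂ) (β : ℂ) (N : ℕ) (z : ℂ) : ℂ :=
  ∑ k ∈ Finset.range N, ((-1 : ℂ) ^ (k - 1) * a k / (Nat.factorial (k - 1) : ℂ)) *
    iteratedDeriv (k - 1) (wzeta P.lattice) (z - β)

variable {P} {a : ℕ → ℂ} {β : ℂ} {N : ℕ}

lemma analyticAt_zetaPart {α : ℂ} (h : α - β ∉ P.lattice) :
    AnalyticAt ℂ (P.zetaPart a β N) α := by
  refine Finset.analyticAt_fun_sum _ fun k _ ↦ analyticAt_const.fun_mul ?_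
  exact (P.analyticAt_iteratedDeriv_wzeta h _).comp_of_eq (f := (· - β)) (by fun_prop) rfl

lemma extAnalyticAt_zetaPart_sub (h0 : a 0 = 0) {α : ℂ} (h : α - β ∈ P.lattice) :
    ExtAnalyticAt (fun z ↦ P.zetaPart a β N z - ∑ k ∈ Finset.range N, a k / (z - α) ^ k) α := by
  simp_rw [zetaPart, ← Finset.sum_sub_distrib]
  refine ExtAnalyticAt.sum fun k _ ↦ ?_
  rcases k with _ | k
  · simpa [h0] using ExtAnalyticAt.of_analyticAt analyticAt_const
  obtain ⟨g, hg, e⟩ := (P.extAnalyticAt_iteratedDeriv_wzeta_sub h k).const_mul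
    ((-1 : ℂ) ^ k * a (k + 1) / (Nat.factorial k : ℂ))
  refine ⟨fun z ↦ g (z - β), hg.comp_of_eq (by fun_prop) rfl, ?_⟩
  have ht := (tendsto_add_const_nhdsNE α (-β)).eventually (sub_eq_add_neg α β ▸ e)
  simp only [← sub_eq_add_neg] at ht
  filter_upwards [ht] with z hz
  rw [← hz]
  have hfac : (Nat.factorial k : ℂ) ≠ 0 := by exact_mod_cast k.factorial_ne_zero
  have hsign : ((-1 : ℂ) ^ k) * (-1) ^ k = 1 := by rw [← mul_pow]; simp
  simp only [Nat.add_sub_cancel, sub_sub_sub_cancel_right]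
  rw [mul_sub]
  congr 1
  field_simp
  linear_combination (-(a (k + 1) / (z - α) ^ (k + 1))) * hsign

lemma zetaPart_add (h0 : a 0 = 0) {l η : ℂ} (hl : l ∈ P.lattice)
    (hη : ∀ z ∉ P.lattice, wzeta P.lattice (z + l) = wzeta P.lattice z + η)
    {z : ℂ} (hz : z - β ∉ P.lattice) :
    P.zetaPart a β N (z + l) =
      P.zetaPart a β N z + (∑ k ∈ Finset.range N, if k = 1 then a k else 0) * η := by
  simp_rw [zetaPart, Finset.sum_mul, ← Finset.sum_add_distrib]
  refine Finset.sum_congr rfl fun k _ ↦ ?_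
  rw [add_sub_right_comm]
  rcases k with _ | _ | k
  · simp [h0]
  · simp [hη _ hz]; ring
  · simp [P.iteratedDeriv_wzeta_add hl]

/-- An elliptic function is determined up to a constant by its principal parts at a finite system
of representatives of its poles. -/
theorem exists_eq_add_sum_zetaPart {f : ℂ → ℂ} (hf : IsElliptic P.lattice f)
    {c : ℂ → ℕ → ℂ} (hc : ∀ α, IsPrincPart f α (c α)) (S : Finset ℂ)
    (hS : ∀ α, c α ≠ 0 → ∃ β ∈ S, α - β ∈ P.lattice)
    (hS' : ∀ β ∈ S, ∀ β' ∈ S, β - β' ∈ P.lattice → β = β')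
    (hN : ∀ β ∈ S, ∀ k, N ≤ k → c β k = 0) :
    ∃ c₀, ∀ z, AnalyticAt ℂ f z → f z = c₀ + ∑ β ∈ S, P.zetaPart (c β) β N z := by
  have hcc : ∀ α β, α - β ∈ P.lattice → c α = c β := fun α β h ↦ by
    simpa using hf.princPart_add_eq hc h β
  have hext : ∀ α, ExtAnalyticAt (fun z ↦ f z - ∑ β ∈ S, P.zetaPart (c β) β N z) α := by
    intro α
    by_cases hα : ∃ β ∈ S, α - β ∈ P.lattice
    · obtain ⟨β, hβ, hαβ⟩ := hα
      have h1 := (hc α).extAnalyticAt_sum (N := N) (hcc α β hαβ ▸ hN β hβ)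
      have h2 := extAnalyticAt_zetaPart_sub (N := N) (hc β).1 hαβ
      have h3 : ExtAnalyticAt (fun z ↦ ∑ β ∈ S.erase β, P.zetaPart (c β) β N z) α := by
        refine .sum fun β' hβ' ↦ .of_analyticAt (analyticAt_zetaPart fun h ↦ ?_)
        refine Finset.ne_of_mem_erase hβ' (hS' _ (Finset.mem_of_mem_erase hβ') _ hβ ?_)
        simpa using sub_mem hαβ h
      refine ((h1.sub h2).sub h3).congr (.of_forall fun z ↦ ?_)
      simp only [← Finset.add_sum_erase S _ hβ, hcc α β hαβ]
      ring
    · push Not at hα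
      have h0 : c α = 0 := by
        by_contra h
        obtain ⟨β, hβ, h⟩ := hS α h
        exact hα β hβ h
      have h1 := (hc α).extAnalyticAt_sum (N := 0) (by simp [h0])
      have h3 : ExtAnalyticAt (fun z ↦ ∑ β ∈ S, P.zetaPart (c β) β N z) α :=
        .sum fun β hβ ↦ .of_analyticAt (analyticAt_zetaPart (hα β hβ))
      simpa using h1.sub h3
  obtain ⟨h, hd, he⟩ := ExtAnalyticAt.exists_entire hext
  choose! η hη using fun l (hl : l ∈ P.lattice) ↦ P.exists_wzeta_add_eq hl
  obtain ⟨A, hA⟩ : ∃ A, ∀ l ∈ P.lattice, ∀ z, h (z + l) = h z + A * η l := by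
    refine ⟨-∑ β ∈ S, ∑ k ∈ Finset.range N, if k = 1 then c β k else 0, fun l hl z ↦ ?_⟩
    refine eq_of_eventuallyEq_nhdsNE (F := fun z ↦ h (z + l)) (G := fun z ↦ h z + _) (α := z)
      (hd.continuous.comp (continuous_add_const l)).continuousAt
      (hd.continuous.add continuous_const).continuousAt ?_
    have hmem : ∀ᶠ w in 𝓝[≠] z, ∀ β ∈ S, w - β ∉ P.lattice := by
      refine (Finset.eventually_all S).mpr fun β _ ↦ ?_
      simpa only [← sub_eq_add_neg] using (tendsto_add_const_nhdsNE z (-β)).eventually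
        (P.eventually_notMem_lattice _)
    filter_upwards [he z, (tendsto_add_const_nhdsNE z l).eventually (he (z + l)), hmem,
      hf.eventually_add_eq hl z] with w h1 h2 h3 h4
    rw [← h1, ← h2, h4,
      Finset.sum_congr rfl fun β hβ ↦ zetaPart_add (hc β).1 hl (hη l hl) (h3 β hβ),
      Finset.sum_add_distrib, ← Finset.sum_mul]
    ring
  have hderiv : ∀ z, deriv h z = deriv h 0 := by
    refine fun z ↦ P.apply_eq_apply_of_periodic (f := deriv h) ?_ (fun l hl z ↦ ?_) z 0
    · exact fun z ↦ (hd.analyticAt z).deriv.differentiableAt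
    · rw [← deriv_comp_add_const, funext (hA l hl), deriv_add_const]
  have hlin : ∀ z, h z = deriv h 0 * z + h 0 := by
    intro z
    have hd' : ∀ z, HasDerivAt (fun z ↦ h z - deriv h 0 * z) 0 z := fun z ↦ by
      simpa [hderiv z] using (hd z).hasDerivAt.fun_sub
        ((hasDerivAt_id z).const_mul (deriv h 0))
    have := is_const_of_deriv_eq_zero (fun z ↦ (hd' z).differentiableAt)
      (fun z ↦ (hd' z).deriv) z 0
    linear_combination this
  have hAη : ∀ l ∈ P.lattice, deriv h 0 * l = A * η l := fun l hl ↦ by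
    have := hA l hl 0
    rw [zero_add, hlin l] at this
    linear_combination this
  have hA0 : A = 0 := by
    by_contra hA0
    refine P.not_forall_wzeta_add_eq (deriv h 0 / A) fun l hl z hz ↦ ?_
    rw [hη l hl z hz, div_mul_eq_mul_div, hAη l hl, mul_div_cancel_left₀ _ hA0]
  have hd0 : deriv h 0 = 0 := by
    have := hAη _ P.ω₁_mem_lattice
    rw [hA0, zero_mul] at this
    refine (mul_eq_zero.mp this).resolve_right fun h0 ↦ P.ω₁_div_two_notMem_lattice ?_
    simp [h0]
  refine ⟨h 0, fun z hz ↦ ?_⟩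
  have hterm : ∀ β ∈ S, AnalyticAt ℂ (P.zetaPart (c β) β N) z := by
    intro β hβ
    by_cases hzβ : z - β ∈ P.lattice
    · have : c β = 0 := (hcc z β hzβ).symm.trans ((hc z).eq_zero_of_analyticAt hz)
      have h0 : P.zetaPart (c β) β N = fun _ ↦ 0 := by
        ext w; simp [zetaPart, this]
      exact h0 ▸ analyticAt_const
    · exact analyticAt_zetaPart hzβ
  have := eq_of_eventuallyEq_nhdsNE
    (hz.fun_sub (S.analyticAt_fun_sum hterm)).continuousAt hd.continuous.continuousAt (he z)
  rw [hlin z, hd0] at this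
  linear_combination this

end PeriodPair

lemma IsLattice.exists_periodPair {L : Set ℂ} (hL : IsLattice L) :
    ∃ P : PeriodPair, L = P.lattice := by
  obtain ⟨ω₁, ω₂, h, rfl⟩ := hL
  refine ⟨⟨ω₁, ω₂, h⟩, ?_⟩
  ext z
  simp [PeriodPair.mem_lattice, eq_comm]

namespace IsPinning

variable {L : Set ℂ} {s : ℂ} {R : Set ℂ}

lemma eq_of_add_eq (hR : IsPinning L s R) {r r' l l' : ℂ} {n n' : ℤ} (hr : r ∈ R) (hr' : r' ∈ R)
    (hl : l ∈ L) (hl' : l' ∈ L) (h : r + n * s + l = r' + n' * s + l') : r = r' ∧ n = n' := by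
  have := (hR (r + n * s + l)).unique (y₁ := (r, n, l)) (y₂ := (r', n', l'))
    ⟨hr, hl, rfl⟩ ⟨hr', hl', h⟩
  simp only [Prod.mk.injEq] at this
  exact ⟨this.1, this.2.1⟩

lemma injOn (hR : IsPinning L s R) (h0 : 0 ∈ L) :
    (R ×ˢ (univ : Set ℤ)).InjOn fun p ↦ p.1 + (p.2 : ℂ) * s := by
  rintro ⟨r, n⟩ ⟨hr, -⟩ ⟨r', n'⟩ ⟨hr', -⟩ h
  obtain ⟨rfl, rfl⟩ := hR.eq_of_add_eq hr hr' h0 h0 (congrArg (· + 0) h)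
  rfl

end IsPinning

theorem stmt1 (L : Set ℂ) (hL : IsLattice L) (s : ℂ)
    (hs : ∀ n : ℕ, 1 ≤ n → (n : ℂ) * s ∉ L)
    (R : Set ℂ) (hR : IsPinning L s R)
    (f : ℂ → ℂ) (hf : IsElliptic L f)
    (c : ℂ → ℕ → ℂ) (hc : ∀ α : ℂ, IsPrincPart f α (c α)) :
    {p : ℂ × ℤ × ℕ | p.1 ∈ R ∧ c (p.1 + (p.2.1 : ℂ) * s) p.2.2 ≠ 0}.Finite ∧
    ∃! c₀ : ℂ, ∀ z : ℂ, AnalyticAt ℂ f z →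
      f z = c₀ + ∑ᶠ r ∈ R, ∑ᶠ n : ℤ, ∑ᶠ k : ℕ,
        ((-1 : ℂ) ^ (k - 1) * c (r + (n : ℂ) * s) k / (Nat.factorial (k - 1) : ℂ)) *
          iteratedDeriv (k - 1) (wzeta L) (z - r - (n : ℂ) * s) := by
  obtain ⟨P, rfl⟩ := hL.exists_periodPair
  set e : ℂ × ℤ → ℂ := fun p ↦ p.1 + (p.2 : ℂ) * s with he
  have hinj : (R ×ˢ (univ : Set ℤ)).InjOn e := hR.injOn P.lattice.zero_mem
  set E : Set ℂ := e '' (R ×ˢ univ) with hE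
  have hEmem : ∀ r ∈ R, ∀ n : ℤ, r + (n : ℂ) * s ∈ E := fun r hr n ↦ ⟨(r, n), ⟨hr, trivial⟩, rfl⟩
  have hEL : ∀ β ∈ E, ∀ β' ∈ E, ∀ l ∈ P.lattice, ∀ l' ∈ P.lattice, β + l = β' + l' → β = β' := by
    rintro _ ⟨p, ⟨hp, -⟩, rfl⟩ _ ⟨p', ⟨hp', -⟩, rfl⟩ l hl l' hl' h
    obtain ⟨h1, h2⟩ := hR.eq_of_add_eq hp hp' hl hl' h
    simp only [he, h1, h2]
  have hT : (E ∩ {α | c α ≠ 0}).Finite := by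
    obtain ⟨K, hK, hKl⟩ := P.exists_isCompact_add_mem
    choose l hl hlK using hKl
    refine Set.Finite.of_injOn (f := fun z ↦ z + l z) ?_ ?_ (hf.finite_inter_of_isCompact hc hK)
    · rintro α ⟨-, hα⟩
      refine ⟨hlK α, ?_⟩
      rwa [Set.mem_ofPred_eq, hf.princPart_add_eq hc (hl α)]
    · rintro α ⟨hα, -⟩ β ⟨hβ, -⟩ h
      exact hEL α hα β hβ _ (hl α) _ (hl β) h
  set S : Finset ℂ := hT.toFinset with hSdef
  choose B hB using fun α ↦ (hc α).exists_bound
  set N : ℕ := S.sup B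
  have hN : ∀ β ∈ E, ∀ k, N ≤ k → c β k = 0 := by
    intro β hβ k hk
    by_cases h0 : c β = 0
    · simp [h0]
    · exact hB β k ((Finset.le_sup (f := B) (by simp [hSdef, hβ, h0])).trans hk)
  refine ⟨?_, ?_⟩
  · refine Set.Finite.of_injOn (f := fun p ↦ (e (p.1, p.2.1), p.2.2)) ?_ ?_
      (hT.prod (Set.finite_Iio N))
    · rintro ⟨r, n, k⟩ ⟨hr, hk⟩
      refine ⟨⟨hEmem r hr n, fun h0 ↦ hk ?_⟩, ?_⟩
      · exact congrFun h0 k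
      · by_contra hk'
        exact hk (hN _ (hEmem r hr n) k (by simpa using hk'))
    · rintro ⟨r, n, k⟩ ⟨hr, -⟩ ⟨r', n', k'⟩ ⟨hr', -⟩ h
      simp only [Prod.mk.injEq] at h
      obtain ⟨h1, h2⟩ := Prod.mk.inj (hinj ⟨hr, trivial⟩ ⟨hr', trivial⟩ h.1)
      rw [h1, h2, h.2]
  have hsum : ∀ z, ∑ᶠ r ∈ R, ∑ᶠ n : ℤ, ∑ᶠ k : ℕ,
        ((-1 : ℂ) ^ (k - 1) * c (r + (n : ℂ) * s) k / (Nat.factorial (k - 1) : ℂ)) *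
          iteratedDeriv (k - 1) (wzeta P.lattice) (z - r - (n : ℂ) * s)
      = ∑ β ∈ S, P.zetaPart (c β) β N z := by
    intro z
    set X : ℂ → ℂ := fun β ↦ P.zetaPart (c β) β N z with hX
    have hX0 : ∀ β, c β = 0 → X β = 0 := fun β h ↦ by simp [hX, PeriodPair.zetaPart, h]
    have hk : ∀ r ∈ R, ∀ n : ℤ, (∑ᶠ k : ℕ,
        ((-1 : ℂ) ^ (k - 1) * c (r + (n : ℂ) * s) k / (Nat.factorial (k - 1) : ℂ)) *
          iteratedDeriv (k - 1) (wzeta P.lattice) (z - r - (n : ℂ) * s)) = X (e (r, n)) := by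
      intro r hr n
      rw [finsum_eq_sum_of_support_subset (s := Finset.range N), sub_sub]
      · rfl
      · intro k hk
        by_contra hk'
        exact hk (by simp [hN _ (hEmem r hr n) k (by simpa using hk')])
    have hmem : ∀ p, (R ×ˢ (univ : Set ℤ)).indicator (X ∘ e) p ≠ 0 →
        p ∈ R ×ˢ (univ : Set ℤ) ∧ e p ∈ E ∩ {α | c α ≠ 0} := by
      intro p hp
      have hpR := Set.mem_of_indicator_ne_zero hp
      rw [Set.indicator_of_mem hpR] at hp
      exact ⟨hpR, ⟨p, hpR, rfl⟩, fun h ↦ hp (hX0 _ h)⟩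
    have hfin : (Function.support ((R ×ˢ (univ : Set ℤ)).indicator (X ∘ e))).Finite :=
      Set.Finite.of_injOn (fun p hp ↦ (hmem p hp).2)
        (hinj.mono fun p hp ↦ (hmem p hp).1) hT
    calc _ = ∑ᶠ (r) (n : ℤ), (R ×ˢ (univ : Set ℤ)).indicator (X ∘ e) (r, n) := by
          refine finsum_congr fun r ↦ ?_
          by_cases hr : r ∈ R
          · simp [hr, hk r hr]
          · simp [hr]
      _ = ∑ᶠ p ∈ R ×ˢ (univ : Set ℤ), X (e p) := by
          rw [← finsum_curry _ hfin, finsum_mem_def]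
          rfl
      _ = ∑ᶠ β ∈ E, X β := finsum_mem_eq_of_bijOn e hinj.bijOn_image fun _ _ ↦ rfl
      _ = _ := finsum_mem_eq_sum_of_subset X
          (fun β hβ ↦ by simpa [hSdef] using ⟨hβ.1, fun h ↦ hβ.2 (hX0 β h)⟩)
          (fun β hβ ↦ by simp only [hSdef, Set.Finite.coe_toFinset] at hβ; exact hβ.1)
  simp_rw [hsum]
  have hSE : ∀ β ∈ S, β ∈ E := fun β hβ ↦ (hT.mem_toFinset.mp hβ).1
  obtain ⟨c₀, h₀⟩ := PeriodPair.exists_eq_add_sum_zetaPart (N := N) hf hc S (fun α hα ↦ by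
      obtain ⟨⟨r, n, l⟩, ⟨hr, hl, h⟩, -⟩ := hR α
      obtain rfl : α = r + n * s + l := h
      refine ⟨r + n * s, ?_, by simpa using hl⟩
      rw [hf.princPart_add_eq hc hl] at hα
      exact hT.mem_toFinset.mpr ⟨hEmem r hr n, hα⟩)
    (fun β hβ β' hβ' h ↦ hEL β (hSE β hβ) β' (hSE β' hβ') 0 P.lattice.zero_mem _ h (by ring))
    (fun β hβ ↦ hN β (hSE β hβ))
  refine ⟨c₀, h₀, fun c₁ h₁ ↦ ?_⟩
  obtain ⟨z, hz⟩ := (hf.eventually_analyticAt 0).exists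
  exact add_right_cancel ((h₁ z hz).symm.trans (h₀ z hz))
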